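/- Let g : 𝕋³ → ℝ be a smooth function such that g(·,·,z) has zero mean on 𝕋² for every z ∈ [0,2π], and suppose that every nonzero Fourier mode k = (k₁,k₂,k₃) ∈ ℤ³ of g satisfies |(k₁,k₂)| ≥ λ for some λ > 0. Then there exists a smooth vector field I : 𝕋³ → ℝ² such that ∇̄ · I = g (i.e. ∂_x I₁ + ∂_y I₂ = g) and ‖I‖_{C⁰} ≤ C λ^{−1} ‖g‖_{C⁰}, with C a universal constant. -/

import Mathlib

open Real MeasureTheory

noncomputable section

/-- Partial derivative of a scalar function in the `i`-th coordinate direction. -/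
def pd3 (i : Fin 3) (f : (Fin 3 → ℝ) → ℝ) (x : Fin 3 → ℝ) : ℝ :=
  fderiv ℝ f x (Pi.single i 1)

/-- The fundamental domain `[0,2π]³` of the torus `𝕋³ = (ℝ/2πℤ)³`. -/
def box3 : Set (Fin 3 → ℝ) := Set.Icc 0 (fun _ => 2 * Real.pi)

/-- The fundamental domain `[0,2π]²` of the torus `𝕋² = (ℝ/2πℤ)²`. -/
def box2 : Set (Fin 2 → ℝ) := Set.Icc 0 (fun _ => 2 * Real.pi)

/-- `2π`-periodicity in each of the three spatial variables. -/
def Periodic3 {E : Type*} (f : (Fin 3 → ℝ) → E) : Prop :=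
  ∀ (x : Fin 3 → ℝ) (i : Fin 3), f (x + Pi.single i (2 * Real.pi)) = f x

/-- The `ℤ³` Fourier coefficient of `F : 𝕋³ → ℂ` at frequency `k = (k̄, k₃) ∈ ℤ² × ℤ`. -/
def fc3 (F : (Fin 3 → ℝ) → ℂ) (k : (ℤ × ℤ) × ℤ) : ℂ :=
  ((2 * Real.pi) ^ 3 : ℝ)⁻¹ • ∫ x in box3,
    F x * Complex.exp (-(Complex.I) *
      Complex.ofReal ((k.1.1 : ℝ) * x 0 + (k.1.2 : ℝ) * x 1 + (k.2 : ℝ) * x 2))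

/-- The Euclidean length of a horizontal frequency `k̄ ∈ ℤ²`. -/
def knorm (k : ℤ × ℤ) : ℝ := Real.sqrt ((k.1 : ℝ) ^ 2 + (k.2 : ℝ) ^ 2)

open scoped FourierTransform ContDiff

theorem exists_bandlimited_kernel (V : Type*) [NormedAddCommGroup V] [InnerProductSpace ℝ V]
    [FiniteDimensional ℝ V] [MeasurableSpace V] [BorelSpace V] :
    ∃ φ : V → ℝ, Continuous φ ∧ Integrable φ ∧ Integrable (fun y => ‖y‖ * |φ y|) ∧
      ∫ y, φ y = 1 ∧
      ∀ ξ : V, 1 ≤ ‖ξ‖ →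
        ∫ y, (φ y : ℂ) * Complex.exp (-Complex.I * (inner ℝ y ξ : ℝ)) = 0 := by
  have hpi := Real.pi_pos
  let b : ContDiffBump (0 : V) := ⟨1 / (4 * π), 1 / (2 * π), by positivity, by
    apply one_div_lt_one_div_of_lt <;> linarith⟩
  have hb1 : HasCompactSupport (fun x => (b x : ℂ)) :=
    b.hasCompactSupport.comp_left (g := Complex.ofReal) rfl
  have hb2 : ContDiff ℝ ∞ (fun x => (b x : ℂ)) := Complex.ofRealCLM.contDiff.comp b.contDiff
  let Φ : SchwartzMap V ℂ := 𝓕⁻ (hb1.toSchwartzMap hb2)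
  have hF : ∀ ξ, ∫ y, Φ y * Complex.exp (-Complex.I * ((2 * π * inner ℝ y ξ : ℝ) : ℂ)) = b ξ := by
    intro ξ
    have h1 : 𝓕 Φ = hb1.toSchwartzMap hb2 := FourierTransform.fourier_fourierInv_eq _
    have h2 := congrArg (fun f : SchwartzMap V ℂ => f ξ) h1
    simp only [SchwartzMap.fourier_coe, HasCompactSupport.toSchwartzMap_toFun,
      Real.fourier_eq'] at h2
    rw [← h2]
    congr 1 with y
    rw [smul_eq_mul, mul_comm]
    congr 2
    push_cast
    ring
  have hb0 : ∀ ξ : V, 1 ≤ ‖ξ‖ → b ((2 * π)⁻¹ • ξ) = 0 := by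
    intro ξ hξ
    apply b.zero_of_le_dist
    rw [dist_zero_right, norm_smul, norm_inv, Real.norm_of_nonneg (by positivity)]
    change 1 / (2 * π) ≤ _
    rw [one_div]
    exact le_mul_of_one_le_right (by positivity) hξ
  have hF' : ∀ ξ : V, 1 ≤ ‖ξ‖ →
      ∫ y, Φ y * Complex.exp (-Complex.I * (inner ℝ y ξ : ℝ)) = 0 := by
    intro ξ hξ
    have := hF ((2 * π)⁻¹ • ξ)
    rw [hb0 ξ hξ] at this
    rw [← Complex.ofReal_zero, ← this]
    congr 1 with y
    rw [inner_smul_right, mul_inv_cancel_left₀ (by positivity)]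
  refine ⟨fun y => (Φ y).re, Complex.continuous_re.comp Φ.continuous, Φ.integrable.re, ?_, ?_, ?_⟩
  · refine (SchwartzMap.integrable_pow_mul volume Φ 1).mono' ?_ (.of_forall fun y => ?_)
    · exact (continuous_norm.mul
        (Complex.continuous_re.comp Φ.continuous).abs).aestronglyMeasurable
    · rw [Real.norm_of_nonneg (by positivity), pow_one]
      gcongr
      exact Complex.abs_re_le_norm _
  · have h := hF 0
    simp only [inner_zero_right, mul_zero, Complex.ofReal_zero, Complex.exp_zero, mul_one] at h
    have h3 : ∫ y, (Φ y).re = (∫ y, Φ y).re := integral_re Φ.integrable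
    rw [h3, h, Complex.ofReal_re]
    exact b.one_of_mem_closedBall (Metric.closedBall_subset_closedBall b.rIn_pos.le (by simp))
  · intro ξ hξ
    have h1 := hF' ξ hξ
    have h2 := congrArg (starRingEnd ℂ) (hF' (-ξ) (by rwa [norm_neg]))
    rw [← integral_conj, map_zero] at h2
    have hint : ∀ f : V → ℂ, Continuous f → (∀ y, ‖f y‖ = 1) → Integrable (fun y => Φ y * f y) :=
      fun f hf hf1 => Φ.integrable.mul_bdd (c := 1) hf.aestronglyMeasurable
        (.of_forall fun y => (hf1 y).le)
    have hn : ∀ y, ‖Complex.exp (-Complex.I * (inner ℝ y ξ : ℝ))‖ = 1 := fun y => by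
      rw [Complex.norm_exp]; simp
    have hn' : ∀ y, ‖Complex.exp (-Complex.I * (inner ℝ y (-ξ) : ℝ))‖ = 1 := fun y => by
      rw [Complex.norm_exp]; simp
    have i1 := hint _ (by fun_prop) hn
    have i2 := hint _ (by fun_prop) hn'
    have key : ∀ y, ((Φ y).re : ℂ) * Complex.exp (-Complex.I * (inner ℝ y ξ : ℝ)) =
        (1 / 2 : ℂ) * (Φ y * Complex.exp (-Complex.I * (inner ℝ y ξ : ℝ)) +
          (starRingEnd ℂ) (Φ y * Complex.exp (-Complex.I * (inner ℝ y (-ξ) : ℝ)))) := by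
      intro y
      rw [map_mul, ← Complex.exp_conj, Complex.re_eq_add_conj]
      simp only [inner_neg_right, map_mul, Complex.conj_I, Complex.conj_ofReal,
        Complex.ofReal_neg, neg_neg, mul_neg, neg_mul]
      ring
    simp_rw [key]
    have i3 : Integrable (fun y => (starRingEnd ℂ)
        (Φ y * Complex.exp (-Complex.I * (inner ℝ y (-ξ) : ℝ)))) :=
      Complex.conjLIE.integrable_comp_iff.2 i2
    rw [integral_const_mul, integral_add i1 i3, h1, h2, add_zero, mul_zero]

theorem Periodic3.add_int_smul {E : Type*} {f : (Fin 3 → ℝ) → E} (hf : Periodic3 f)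
    (x : Fin 3 → ℝ) (n : Fin 3 → ℤ) : f (x + fun i => 2 * π * n i) = f x := by
  have h1 : ∀ (i : Fin 3) (m : ℤ) (x : Fin 3 → ℝ),
      f (x + m • Pi.single i (2 * π)) = f x := fun i m x =>
    Function.Periodic.zsmul (f := f) (fun x => hf x i) m x
  have h2 : (fun i => 2 * π * n i : Fin 3 → ℝ) = n 0 • Pi.single 0 (2 * π) +
      n 1 • Pi.single 1 (2 * π) + n 2 • Pi.single 2 (2 * π) := by
    ext i
    fin_cases i <;> simp [mul_comm]
  rw [h2, ← add_assoc, ← add_assoc, h1, h1, h1]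

theorem Periodic3.exists_mem_box3 {E : Type*} {f : (Fin 3 → ℝ) → E} (hf : Periodic3 f)
    (x : Fin 3 → ℝ) : ∃ y ∈ box3, f y = f x := by
  have hp : (0 : ℝ) < 2 * π := by positivity
  refine ⟨x + fun i => 2 * π * (-⌊x i / (2 * π)⌋ : ℤ), ⟨fun i => ?_, fun i => ?_⟩,
    hf.add_int_smul x _⟩
  · have := (le_div_iff₀ hp).1 (Int.floor_le (x i / (2 * π)))
    simp only [Pi.zero_apply, Pi.add_apply, Int.cast_neg]
    linarith
  · have := (div_lt_iff₀ hp).1 (Int.lt_floor_add_one (x i / (2 * π)))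
    simp only [Pi.add_apply, Int.cast_neg]
    linarith

theorem Periodic3.exists_norm_le {E : Type*} [NormedAddCommGroup E] {f : (Fin 3 → ℝ) → E}
    (hf : Periodic3 f) (hc : Continuous f) : ∃ C, ∀ x, ‖f x‖ ≤ C := by
  obtain ⟨C, hC⟩ := (isCompact_Icc (a := (0 : Fin 3 → ℝ))
    (b := fun _ => 2 * π)).exists_bound_of_continuousOn hc.continuousOn
  refine ⟨C, fun x => ?_⟩
  obtain ⟨y, hy, hxy⟩ := hf.exists_mem_box3 x
  exact hxy ▸ hC y hy

theorem Periodic3.fderiv {E : Type*} [NormedAddCommGroup E] [NormedSpace ℝ E]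
    {f : (Fin 3 → ℝ) → E} (hf : Periodic3 f) : Periodic3 (fderiv ℝ f) := by
  intro x i
  rw [← fderiv_comp_add_right]
  congr 1
  ext1 y
  exact hf y i

section WeightedTranslates

variable {Ω : Type*} [MeasurableSpace Ω] {μ : Measure Ω} {w : Ω → ℝ} {τ : Ω → Fin 3 → ℝ}

theorem integrable_smul_translate {F : Type*} [NormedAddCommGroup F] [NormedSpace ℝ F]
    (hw : Integrable w μ) (hτ : Measurable τ) {f : (Fin 3 → ℝ) → F} (hf : Continuous f)
    (hp : Periodic3 f) (x : Fin 3 → ℝ) : Integrable (fun a => w a • f (x + τ a)) μ := by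
  obtain ⟨C, hC⟩ := hp.exists_norm_le hf
  refine hw.smul_bdd C ?_ (.of_forall fun a => hC _)
  exact hf.comp_aestronglyMeasurable ((hτ.const_add x).aestronglyMeasurable)

theorem hasFDerivAt_integral_smul_translate {F : Type*} [NormedAddCommGroup F] [NormedSpace ℝ F]
    (hw : Integrable w μ) (hτ : Measurable τ) {f : (Fin 3 → ℝ) → F} (hf : ContDiff ℝ ∞ f)
    (hp : Periodic3 f) (x : Fin 3 → ℝ) :
    HasFDerivAt (fun x => ∫ a, w a • f (x + τ a) ∂μ)
      (∫ a, w a • fderiv ℝ f (x + τ a) ∂μ) x := by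
  have hf' : Continuous (fderiv ℝ f) := hf.continuous_fderiv (by simp)
  obtain ⟨C, hC⟩ := hp.fderiv.exists_norm_le hf'
  refine hasFDerivAt_integral_of_dominated_of_fderiv_le (bound := fun a => ‖w a‖ * C)
    (F' := fun x a => w a • fderiv ℝ f (x + τ a)) Filter.univ_mem
    (.of_forall fun y => (integrable_smul_translate hw hτ hf.continuous hp y).1)
    (integrable_smul_translate hw hτ hf.continuous hp x)
    (integrable_smul_translate hw hτ hf' hp.fderiv x).1
    (.of_forall fun a y _ => ?_) (hw.norm.mul_const C) (.of_forall fun a y _ => ?_)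
  · rw [norm_smul]
    gcongr
    exact hC _
  · have h : HasFDerivAt f (fderiv ℝ f (y + τ a)) (y + τ a) :=
      (hf.differentiable (by simp) _).hasFDerivAt
    exact ((hasFDerivAt_comp_add_right (τ a)).2 h).const_smul (w a)

theorem contDiff_integral_smul_translate {F : Type*} [NormedAddCommGroup F] [NormedSpace ℝ F]
    (hw : Integrable w μ) (hτ : Measurable τ) {f : (Fin 3 → ℝ) → F} (hf : ContDiff ℝ ∞ f)
    (hp : Periodic3 f) : ContDiff ℝ ∞ (fun x => ∫ a, w a • f (x + τ a) ∂μ) := by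
  rw [contDiff_infty]
  intro n
  induction n generalizing F with
  | zero =>
    exact contDiff_zero.2 (continuous_iff_continuousAt.2 fun x =>
      (hasFDerivAt_integral_smul_translate hw hτ hf hp x).continuousAt)
  | succ n ih =>
    exact contDiff_succ_iff_hasFDerivAt.2 ⟨_, ih (hf.fderiv_right (by simp)) hp.fderiv,
      hasFDerivAt_integral_smul_translate hw hτ hf hp⟩

theorem Periodic3.integral_smul_translate {F : Type*} [NormedAddCommGroup F] [NormedSpace ℝ F]
    {f : (Fin 3 → ℝ) → F} (hp : Periodic3 f) :
    Periodic3 (fun x => ∫ a, w a • f (x + τ a) ∂μ) := by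
  intro x i
  simp only [add_right_comm x, hp _ i]

theorem norm_integral_smul_translate_le {F : Type*} [NormedAddCommGroup F] [NormedSpace ℝ F]
    (hw : Integrable w μ) {f : (Fin 3 → ℝ) → F} {M : ℝ} (hM : ∀ x, ‖f x‖ ≤ M) (x : Fin 3 → ℝ) :
    ‖∫ a, w a • f (x + τ a) ∂μ‖ ≤ (∫ a, |w a| ∂μ) * M := by
  rw [← integral_mul_const]
  refine norm_integral_le_of_norm_le (hw.abs.mul_const M) (.of_forall fun a => ?_)
  rw [norm_smul, Real.norm_eq_abs]
  gcongr
  exact hM _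

end WeightedTranslates

theorem Periodic3.exists_torus_lift {f : (Fin 3 → ℝ) → ℂ} (hp : Periodic3 f)
    (hf : Continuous f) :
    ∃ F : C(UnitAddTorus (Fin 3), ℂ), ∀ x : Fin 3 → ℝ, F (fun i => x i) = f ((2 * π) • x) := by
  have hq : IsOpenQuotientMap
      (Pi.map fun (_ : Fin 3) (t : ℝ) => (t : UnitAddCircle)) :=
    .piMap fun _ => QuotientAddGroup.isOpenQuotientMap_mk
  have hc : ∀ x y : Fin 3 → ℝ, Pi.map (fun (_ : Fin 3) (t : ℝ) => (t : UnitAddCircle)) x =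
      Pi.map (fun (_ : Fin 3) (t : ℝ) => (t : UnitAddCircle)) y →
      f ((2 * π) • x) = f ((2 * π) • y) := by
    intro x y h
    have h1 : ∀ i, ∃ n : ℤ, n • (1 : ℝ) = y i - x i := fun i => by
      have := congrFun h i
      exact AddSubgroup.mem_zmultiples_iff.1 (by
        simpa [neg_add_eq_sub] using QuotientAddGroup.eq.1 this)
    choose n hn using h1
    rw [← hp.add_int_smul _ n]
    congr 1
    ext i
    have := hn i
    simp only [zsmul_eq_mul, mul_one] at this
    simp only [Pi.add_apply, Pi.smul_apply, smul_eq_mul, this]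
    ring
  have hs := hq.surjective
  refine ⟨⟨fun t => f ((2 * π) • Function.surjInv hs t), ?_⟩, fun x => ?_⟩
  · rw [hq.isQuotientMap.continuous_iff]
    have : (fun t => f ((2 * π) • Function.surjInv hs t)) ∘
        (Pi.map fun (_ : Fin 3) (t : ℝ) => (t : UnitAddCircle)) =
        fun x => f ((2 * π) • x) := by
      ext x
      exact hc _ _ (Function.surjInv_eq hs _)
    rw [this]
    fun_prop
  · exact hc _ _ (Function.surjInv_eq hs _)

open scoped Pointwise in
theorem setIntegral_unitBox_comp_smul (q : (Fin 3 → ℝ) → ℂ) :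
    ∫ x in {x : Fin 3 → ℝ | ∀ i, x i ∈ Set.Ioc ((0 : Fin 3 → ℝ) i) ((0 : Fin 3 → ℝ) i + 1)},
      q ((2 * π) • x) = ((2 * π) ^ 3 : ℝ)⁻¹ • ∫ x in box3, q x := by
  have hp : (0 : ℝ) < 2 * π := by positivity
  rw [Measure.setIntegral_comp_smul_of_pos _ _ _ hp, Module.finrank_fin_fun]
  congr 1
  apply setIntegral_congr_set
  have h : (2 * π) • {x : Fin 3 → ℝ | ∀ i,
      x i ∈ Set.Ioc ((0 : Fin 3 → ℝ) i) ((0 : Fin 3 → ℝ) i + 1)} =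
      Set.univ.pi fun i => Set.Ioc ((0 : Fin 3 → ℝ) i) (2 * π) := by
    ext x
    rw [Set.mem_smul_set_iff_inv_smul_mem₀ hp.ne']
    simp only [Set.mem_ofPred_eq, Set.mem_univ_pi]
    refine forall_congr' fun i => ?_
    simp only [Pi.smul_apply, smul_eq_mul, Pi.zero_apply, zero_add, Set.mem_Ioc,
      inv_mul_le_one₀ hp]
    rw [mul_pos_iff_of_pos_left (inv_pos.2 hp)]
  rw [h]
  exact Measure.univ_pi_Ioc_ae_eq_Icc

theorem Periodic3.setIntegral_box3_translate {f : (Fin 3 → ℝ) → ℂ} (hp : Periodic3 f)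
    (hf : Continuous f) (v : Fin 3 → ℝ) :
    ∫ x in box3, f (x + v) = ∫ x in box3, f x := by
  have hpi : (0 : ℝ) < 2 * π := by positivity
  obtain ⟨F, hF⟩ := hp.exists_torus_lift hf
  have h0 := UnitAddTorus.mFourierCoeff_eq_integral F 0 0
  have h1 := UnitAddTorus.mFourierCoeff_eq_integral F 0 ((2 * π)⁻¹ • v)
  simp only [neg_zero, UnitAddTorus.mFourier_zero, ContinuousMap.one_apply, one_smul, hF]
    at h0 h1
  rw [h0, setIntegral_unitBox_comp_smul] at h1
  have h2 := setIntegral_unitBox_comp_smul fun x => f (x + v)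
  have h3 : ((2 * π) ^ 3 : ℝ)⁻¹ ≠ 0 := by positivity
  apply smul_right_injective ℂ h3
  simp only
  rw [h1, ← h2, ← (measurePreserving_add_right volume ((2 * π)⁻¹ • v)).setIntegral_preimage_emb
      (measurableEmbedding_addRight _) (fun x => f ((2 * π) • x))]
  congr 1
  · congr 1
    ext x
    simp only [Set.mem_ofPred_eq, Set.mem_preimage, Pi.zero_apply, Pi.add_apply, Set.mem_Ioc]
    refine forall_congr' fun i => ?_
    constructor <;> rintro ⟨h4, h5⟩ <;> constructor <;> linarith
  · ext x
    rw [smul_add, smul_inv_smul₀ hpi.ne']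

theorem Periodic3.eq_zero_of_fc3_eq_zero {f : (Fin 3 → ℝ) → ℂ} (hp : Periodic3 f)
    (hf : Continuous f) (h : ∀ k, fc3 f k = 0) (x : Fin 3 → ℝ) : f x = 0 := by
  have hpi : (0 : ℝ) < 2 * π := by positivity
  obtain ⟨F, hF⟩ := hp.exists_torus_lift hf
  have hcoeff : UnitAddTorus.mFourierCoeff F = 0 := by
    ext n
    rw [UnitAddTorus.mFourierCoeff_eq_integral F n 0, Pi.zero_apply, ← h ((n 0, n 1), n 2), fc3,
      ← setIntegral_unitBox_comp_smul]
    congr 1 with x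
    rw [hF, smul_eq_mul, mul_comm]
    congr 1
    simp only [UnitAddTorus.mFourier, ContinuousMap.coe_mk, fourier_coe_apply, Fin.prod_univ_three,
      ← Complex.exp_add]
    congr 1
    simp
    ring
  have hs := UnitAddTorus.hasSum_mFourier_series_apply_of_summable
    (f := F) (by rw [hcoeff]; exact summable_zero) (fun i => (((2 * π)⁻¹ • x) i : ℝ))
  rw [hF, smul_inv_smul₀ hpi.ne', hcoeff] at hs
  simpa using hs.unique (by simp)

theorem fc3_zero_eq_zero_of_slice_mean_zero {g : (Fin 3 → ℝ) → ℝ} (hg : Continuous g)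
    (h : ∀ z : ℝ, (∫ y in box2, g ![y 0, y 1, z]) = 0) : fc3 (fun x => (g x : ℂ)) 0 = 0 := by
  have hmp := (volume_preserving_piFinSuccAbove (fun _ : Fin 3 => ℝ) 2).symm
  have hins : ∀ (z : ℝ) (y : Fin 2 → ℝ),
      (MeasurableEquiv.piFinSuccAbove (fun _ : Fin 3 => ℝ) 2).symm (z, y) = ![y 0, y 1, z] := by
    intro z y
    rw [← MeasurableEquiv.eq_symm_apply, MeasurableEquiv.symm_symm]
    refine Prod.ext rfl ?_
    ext i
    fin_cases i <;> rfl
  have hpre : (MeasurableEquiv.piFinSuccAbove (fun _ : Fin 3 => ℝ) 2).symm ⁻¹' box3 =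
      Set.Icc 0 (2 * π) ×ˢ box2 := by
    ext ⟨z, y⟩
    rw [Set.mem_preimage, hins]
    simp only [box3, box2, Set.mem_Icc, Pi.le_def, Fin.forall_fin_succ, Set.mem_prod]
    simp
    tauto
  have hint : ∫ x in box3, g x = 0 := by
    rw [← hmp.setIntegral_preimage_emb (MeasurableEquiv.measurableEmbedding _), hpre]
    have hc : Continuous fun p : ℝ × (Fin 2 → ℝ) => g ![p.2 0, p.2 1, p.1] := by
      refine hg.comp (continuous_pi fun i => ?_)
      fin_cases i <;> simp <;> fun_prop
    have hcg : (fun p : ℝ × (Fin 2 → ℝ) =>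
        g ((MeasurableEquiv.piFinSuccAbove (fun _ : Fin 3 => ℝ) 2).symm p)) =
        fun p => g ![p.2 0, p.2 1, p.1] := funext fun p => by rw [hins p.1 p.2]
    rw [hcg, Measure.volume_eq_prod, setIntegral_prod _
      (hc.continuousOn.integrableOn_compact (K := Set.Icc 0 (2 * π) ×ˢ box2)
        (isCompact_Icc.prod isCompact_Icc))]
    simp [h]
  simp only [fc3, Prod.fst_zero, Prod.snd_zero, Int.cast_zero, zero_mul, add_zero,
    Complex.ofReal_zero, mul_zero, Complex.exp_zero, mul_one]
  rw [integral_complex_ofReal, hint, Complex.ofReal_zero, smul_zero]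

theorem fc3_translate {F : (Fin 3 → ℝ) → ℂ} (hp : Periodic3 F) (hF : Continuous F)
    (v : Fin 3 → ℝ) (k : (ℤ × ℤ) × ℤ) :
    fc3 (fun x => F (x + v)) k = Complex.exp (Complex.I *
      Complex.ofReal ((k.1.1 : ℝ) * v 0 + (k.1.2 : ℝ) * v 1 + (k.2 : ℝ) * v 2)) * fc3 F k := by
  have hp' : Periodic3 fun x : Fin 3 → ℝ => F x * Complex.exp (-(Complex.I) *
      Complex.ofReal ((k.1.1 : ℝ) * x 0 + (k.1.2 : ℝ) * x 1 + (k.2 : ℝ) * x 2)) := by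
    intro x i
    simp only [hp x i]
    congr 1
    rw [Complex.exp_eq_exp_iff_exists_int]
    refine ⟨-(![k.1.1, k.1.2, k.2] i), ?_⟩
    fin_cases i <;> simp <;> ring
  rw [fc3, fc3, ← hp'.setIntegral_box3_translate (by fun_prop) v, mul_smul_comm,
    ← integral_const_mul]
  congr 2 with x
  rw [mul_left_comm, ← Complex.exp_add]
  congr 2
  simp
  ring

theorem fc3_integral_smul_translate {Ω : Type*} [MeasurableSpace Ω] {μ : Measure Ω} [SFinite μ]
    {w : Ω → ℝ} {τ : Ω → Fin 3 → ℝ} (hw : Integrable w μ) (hτ : Measurable τ)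
    {F : (Fin 3 → ℝ) → ℂ} (hF : Continuous F) (hp : Periodic3 F) (k : (ℤ × ℤ) × ℤ) :
    fc3 (fun x => ∫ a, w a • F (x + τ a) ∂μ) k =
      (∫ a, (w a : ℂ) * Complex.exp (Complex.I * Complex.ofReal
        ((k.1.1 : ℝ) * τ a 0 + (k.1.2 : ℝ) * τ a 1 + (k.2 : ℝ) * τ a 2)) ∂μ) * fc3 F k := by
  obtain ⟨C, hC⟩ := hp.exists_norm_le hF
  have : IsFiniteMeasure (volume.restrict box3) := ⟨by
    rw [Measure.restrict_apply_univ]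
    exact isCompact_Icc.measure_lt_top⟩
  rw [← integral_mul_const]
  simp_rw [mul_assoc, ← fc3_translate hp hF, fc3, mul_smul_comm]
  rw [integral_smul]
  congr 1
  simp_rw [← integral_mul_const, ← integral_const_mul]
  rw [integral_integral_swap]
  · simp only [Complex.real_smul, mul_assoc]
  · have h1 : Integrable (fun p : (Fin 3 → ℝ) × Ω => w p.2) ((volume.restrict box3).prod μ) :=
      hw.comp_snd _
    have h2 : Measurable fun p : (Fin 3 → ℝ) × Ω => F (p.1 + τ p.2) :=
      hF.measurable.comp (measurable_fst.add (hτ.comp measurable_snd))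
    have h3 : Measurable fun p : (Fin 3 → ℝ) × Ω => Complex.exp (-(Complex.I) *
        Complex.ofReal ((k.1.1 : ℝ) * p.1 0 + (k.1.2 : ℝ) * p.1 1 + (k.2 : ℝ) * p.1 2)) :=
      Measurable.comp (g := fun x : Fin 3 → ℝ => Complex.exp (-(Complex.I) *
        Complex.ofReal ((k.1.1 : ℝ) * x 0 + (k.1.2 : ℝ) * x 1 + (k.2 : ℝ) * x 2)))
        (by fun_prop) measurable_fst
    refine ((h1.smul_bdd C h2.aestronglyMeasurable (.of_forall fun p => hC _))).mul_bdd (c := 1)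
      h3.aestronglyMeasurable (.of_forall fun p => ?_)
    rw [Complex.norm_exp]
    simp

/-- The horizontal vector `y ∈ ℝ²` seen as a vector of `ℝ³`. -/
def horizontal (y : EuclideanSpace ℝ (Fin 2)) : Fin 3 → ℝ :=
  ∑ j : Fin 2, y j • Pi.single j.castSucc 1

theorem continuous_horizontal : Continuous horizontal := by
  unfold horizontal
  fun_prop

theorem integral_smul_horizontal_translate_eq_zero {φ : EuclideanSpace ℝ (Fin 2) → ℝ}
    (hφ : Integrable φ)
    (hband : ∀ ξ : EuclideanSpace ℝ (Fin 2), 1 ≤ ‖ξ‖ →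
      ∫ y, (φ y : ℂ) * Complex.exp (-Complex.I * (inner ℝ y ξ : ℝ)) = 0)
    {g : (Fin 3 → ℝ) → ℝ} (hg : ContDiff ℝ ∞ g) (hp : Periodic3 g) {lam : ℝ} (hlam : 0 < lam)
    (hfreq : ∀ k, fc3 (fun x => (g x : ℂ)) k ≠ 0 → lam ≤ knorm k.1) (x : Fin 3 → ℝ) :
    ∫ y, φ y • g (x + -(lam⁻¹ • horizontal y)) = 0 := by
  set τ : EuclideanSpace ℝ (Fin 2) → Fin 3 → ℝ := fun y => -(lam⁻¹ • horizontal y)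
  have hτ : Measurable τ := (continuous_horizontal.const_smul lam⁻¹).neg.measurable
  have hp' : Periodic3 fun x => (g x : ℂ) := fun x i => congrArg _ (hp x i)
  have hg' : ContDiff ℝ ∞ fun x => (g x : ℂ) := Complex.ofRealCLM.contDiff.comp hg
  have h : ∫ y, φ y • (g (x + τ y) : ℂ) = 0 := by
    refine hp'.integral_smul_translate.eq_zero_of_fc3_eq_zero
      (contDiff_integral_smul_translate hφ hτ hg' hp').continuous (fun k => ?_) x
    rw [fc3_integral_smul_translate hφ hτ hg'.continuous hp']
    by_cases hk : fc3 (fun x => (g x : ℂ)) k = 0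
    · rw [hk, mul_zero]
    · have hle := hfreq k hk
      let ξ : EuclideanSpace ℝ (Fin 2) := lam⁻¹ • !₂[(k.1.1 : ℝ), (k.1.2 : ℝ)]
      have hξ : 1 ≤ ‖ξ‖ := by
        rw [norm_smul, EuclideanSpace.norm_eq, Fin.sum_univ_two,
          Real.norm_of_nonneg (inv_nonneg.2 hlam.le), ← div_eq_inv_mul, one_le_div hlam]
        simpa [knorm] using hle
      rw [← zero_mul (fc3 (fun x => (g x : ℂ)) k), ← hband ξ hξ]
      congr 3 with y
      congr 2
      simp [ξ, τ, horizontal, PiLp.inner_apply, Fin.sum_univ_two]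
      ring
  apply Complex.ofReal_injective
  rw [Complex.ofReal_zero, ← h, ← integral_complex_ofReal]
  simp [τ]

theorem intervalIntegral_fderiv_neg_smul {g : (Fin 3 → ℝ) → ℝ} (hg : ContDiff ℝ ∞ g)
    (x v : Fin 3 → ℝ) :
    ∫ s in (0 : ℝ)..1, fderiv ℝ g (x + -(s • v)) v = g x - g (x + -v) := by
  have hd : ∀ s : ℝ, HasDerivAt (fun s : ℝ => -g (x + -(s • v)))
      (fderiv ℝ g (x + -(s • v)) v) s := fun s => by
    have h1 : HasDerivAt (fun s : ℝ => x + -(s • v)) (-v) s := by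
      simpa using (((hasDerivAt_id s).smul_const v).neg).const_add x
    have h2 := (((hg.differentiable (by simp) _).hasFDerivAt).comp_hasDerivAt s h1).neg
    rw [map_neg, neg_neg] at h2
    exact h2
  rw [intervalIntegral.integral_eq_sub_of_hasDerivAt (fun s _ => hd s)]
  · simp
    ring
  · have : Continuous (fderiv ℝ g) := hg.continuous_fderiv (by simp)
    exact Continuous.intervalIntegrable (by fun_prop) _ _

/-- **Inverse horizontal divergence of a scalar function.**
If `g` has zero mean on every horizontal slice and all its nonzero Fourier modes have
horizontal frequency at least `λ`, then there is a horizontal vector field `I` with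
`∇̄ · I = g` and `‖I‖_{C⁰} ≤ C λ⁻¹ ‖g‖_{C⁰}`. -/
theorem inverse_divergence_of_scalar :
    ∃ C : ℝ, 0 < C ∧
      ∀ g : (Fin 3 → ℝ) → ℝ, ContDiff ℝ (⊤ : ℕ∞) g → Periodic3 g →
        (∀ z : ℝ, (∫ y in box2, g ![y 0, y 1, z]) = 0) →
        ∀ lam : ℝ, 0 < lam →
        (∀ k : (ℤ × ℤ) × ℤ, k ≠ 0 → fc3 (fun x => (g x : ℂ)) k ≠ 0 → lam ≤ knorm k.1) →
        ∃ I : (Fin 3 → ℝ) → Fin 2 → ℝ,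
          ContDiff ℝ (⊤ : ℕ∞) I ∧ Periodic3 I ∧
          -- ∇̄ · I = g
          (∀ x, (∑ j : Fin 2, pd3 j.castSucc (fun y => I y j) x) = g x) ∧
          -- C⁰ bound
          (∀ x, ‖I x‖ ≤ C * lam⁻¹ * ⨆ y, |g y|) := by
  obtain ⟨φ, hφc, hφ, hφ1, hφm, hband⟩ := exists_bandlimited_kernel (EuclideanSpace ℝ (Fin 2))
  have hK : 0 ≤ ∫ y, ‖y‖ * |φ y| := integral_nonneg fun y => by positivity
  refine ⟨(∫ y, ‖y‖ * |φ y|) + 1, by positivity, fun g hg hp hmean lam hlam hfreq => ?_⟩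
  have hfreq' : ∀ k, fc3 (fun x => (g x : ℂ)) k ≠ 0 → lam ≤ knorm k.1 := fun k hk =>
    hfreq k (fun h0 => hk (h0 ▸ fc3_zero_eq_zero_of_slice_mean_zero hg.continuous hmean)) hk
  let μ : Measure (EuclideanSpace ℝ (Fin 2) × ℝ) :=
    volume.prod (volume.restrict (Set.Ioc (0 : ℝ) 1))
  let w : Fin 2 → EuclideanSpace ℝ (Fin 2) × ℝ → ℝ := fun j p => lam⁻¹ * (φ p.1 * p.1 j)
  let τ : EuclideanSpace ℝ (Fin 2) × ℝ → Fin 3 → ℝ :=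
    fun p => -(p.2 • lam⁻¹ • horizontal p.1)
  have hτ : Measurable τ := Continuous.measurable
    (continuous_snd.smul ((continuous_horizontal.comp continuous_fst).const_smul lam⁻¹)).neg
  have hdom : Integrable (fun p : EuclideanSpace ℝ (Fin 2) × ℝ => lam⁻¹ * (‖p.1‖ * |φ p.1|)) μ :=
    (hφ1.comp_fst _).const_mul _
  have hle : ∀ j p, ‖w j p‖ ≤ lam⁻¹ * (‖p.1‖ * |φ p.1|) := fun j p => by
    rw [norm_mul, norm_mul, Real.norm_of_nonneg (inv_nonneg.2 hlam.le), mul_comm ‖φ p.1‖]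
    gcongr
    · exact PiLp.norm_apply_le _ _
    · exact le_rfl
  have hw : ∀ j, Integrable (w j) μ := fun j =>
    hdom.mono' (Continuous.aestronglyMeasurable (by fun_prop)) (.of_forall (hle j))
  have hwK : ∀ j, ∫ p, |w j p| ∂μ ≤ lam⁻¹ * ∫ y, ‖y‖ * |φ y| := fun j => by
    refine (integral_mono (hw j).abs hdom (hle j)).trans_eq ?_
    rw [integral_const_mul, integral_fun_fst (fun y => ‖y‖ * |φ y|)]
    simp
  have hbdd : BddAbove (Set.range fun y => |g y|) := by
    obtain ⟨C, hC⟩ := hp.exists_norm_le hg.continuous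
    exact ⟨C, Set.forall_mem_range.2 hC⟩
  have hM : ∀ y, ‖g y‖ ≤ ⨆ y, |g y| := le_ciSup hbdd
  have hM0 : 0 ≤ ⨆ y, |g y| := (norm_nonneg _).trans (hM 0)
  refine ⟨fun x j => ∫ p, w j p • g (x + τ p) ∂μ, ?_, ?_, fun x => ?_, fun x => ?_⟩
  · exact contDiff_pi.2 fun j => contDiff_integral_smul_translate (hw j) hτ hg hp
  · exact fun x i => funext fun j => hp.integral_smul_translate x i
  · have hg' : Continuous (fderiv ℝ g) := hg.continuous_fderiv (by simp)
    have hi : ∀ j, Integrable (fun p => w j p • fderiv ℝ g (x + τ p)) μ := fun j =>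
      integrable_smul_translate (hw j) hτ hg' hp.fderiv x
    have hpd : ∀ j : Fin 2, pd3 j.castSucc (fun y => ∫ p, w j p • g (y + τ p) ∂μ) x =
        ∫ p, (w j p • fderiv ℝ g (x + τ p)) (Pi.single j.castSucc 1) ∂μ := fun j => by
      rw [pd3, (hasFDerivAt_integral_smul_translate (hw j) hτ hg hp x).fderiv,
        ContinuousLinearMap.integral_apply (hi j)]
    have hsum : ∀ p, ∑ j, (w j p • fderiv ℝ g (x + τ p)) (Pi.single j.castSucc 1) =
        φ p.1 * fderiv ℝ g (x + τ p) (lam⁻¹ • horizontal p.1) := fun p => by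
      simp only [horizontal, map_smul, map_sum, smul_apply, smul_eq_mul,
        Finset.mul_sum, w]
      refine Finset.sum_congr rfl fun j _ => ?_
      ring
    have hi' : Integrable (fun p => φ p.1 * fderiv ℝ g (x + τ p) (lam⁻¹ • horizontal p.1)) μ := by
      simp_rw [← hsum]
      exact integrable_finsetSum _ fun j _ => (hi j).apply_continuousLinearMap _
    simp_rw [hpd]
    rw [← integral_finsetSum _ fun j _ => (hi j).apply_continuousLinearMap _]
    simp_rw [hsum]
    rw [integral_prod _ hi']
    simp_rw [integral_const_mul, τ, ← intervalIntegral.integral_of_le zero_le_one,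
      intervalIntegral_fderiv_neg_smul hg, mul_sub]
    have hτ' : Measurable fun y => -(lam⁻¹ • horizontal y) :=
      (continuous_horizontal.const_smul lam⁻¹).neg.measurable
    have h0 := integral_smul_horizontal_translate_eq_zero hφ hband hg hp hlam hfreq' x
    have hi0 := integrable_smul_translate hφ hτ' hg.continuous hp x
    simp only [smul_eq_mul] at h0 hi0
    rw [integral_sub (hφ.mul_const _) hi0, h0, integral_mul_const, hφm, one_mul, sub_zero]
  · refine (pi_norm_le_iff_of_nonneg (by positivity)).2 fun j => ?_
    refine (norm_integral_smul_translate_le (hw j) hM x).trans ?_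
    gcongr
    refine (hwK j).trans ?_
    rw [mul_comm]
    gcongr
    linarith

end
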